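/- For every i with 1 ≤ i ≤ k, the matrix B_{i,1} commutes with A: A · B_{i,1} = B_{i,1} · A (equivalently, (A − λ_i I) B_{i,1} = B_{i,1} (A − λ_i I)). -/

import Mathlib

open Matrix Polynomial

theorem pf_unique {k : ℕ} (lam : Fin k → ℂ) (hlam : Function.Injective lam)
    (r : Fin k → ℕ) (c : Fin k → ℕ → ℂ)
    (h : ∀ s : ℂ, (∀ i, s ≠ lam i) →
      ∑ i, ∑ j ∈ Finset.Icc 1 (r i), ((s - lam i) ^ j)⁻¹ * c i j = 0)
    (i₀ : Fin k) (m : ℕ) (h1 : 1 ≤ m) (hm : m ≤ r i₀)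
    (hz : ∀ j, m < j → j ≤ r i₀ → c i₀ j = 0) : c i₀ m = 0 := by
  let G : ℂ → ℂ := fun s =>
    (s - lam i₀) ^ m * (∑ i ∈ Finset.univ.erase i₀, ∑ j ∈ Finset.Icc 1 (r i),
      ((s - lam i) ^ j)⁻¹ * c i j)
    + ∑ j ∈ Finset.Icc 1 (r i₀), (if j ≤ m then (s - lam i₀) ^ (m - j) * c i₀ j else 0)
  have hcont : ContinuousAt G (lam i₀) := by
    apply ContinuousAt.add
    · apply ContinuousAt.mul (by fun_prop)
      apply tendsto_finsetSum
      intro i hi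
      apply tendsto_finsetSum
      intro j _
      have hne : lam i₀ - lam i ≠ 0 :=
        sub_ne_zero.2 fun e => (Finset.mem_erase.1 hi).1 (hlam e).symm
      apply ContinuousAt.mul _ continuousAt_const
      exact ContinuousAt.inv₀ (by fun_prop) (pow_ne_zero _ hne)
    · apply tendsto_finsetSum
      intro j _
      split_ifs
      · exact ContinuousAt.mul (by fun_prop) continuousAt_const
      · exact tendsto_const_nhds
  have hev : ∀ᶠ s in nhdsWithin (lam i₀) {lam i₀}ᶜ, G s = 0 := by
    have h2 : ∀ᶠ s in nhdsWithin (lam i₀) {lam i₀}ᶜ, ∀ i, s ≠ lam i := by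
      rw [Filter.eventually_all]
      intro i
      by_cases hi : i = i₀
      · subst hi
        exact self_mem_nhdsWithin
      · exact nhdsWithin_le_nhds (isOpen_ne.mem_nhds fun e => hi (hlam e).symm)
    filter_upwards [h2] with s hs
    have hne : s - lam i₀ ≠ 0 := sub_ne_zero.2 (hs i₀)
    have e := h s hs
    rw [← Finset.sum_erase_add _ _ (Finset.mem_univ i₀)] at e
    have e2 : ∑ j ∈ Finset.Icc 1 (r i₀),
        (if j ≤ m then (s - lam i₀) ^ (m - j) * c i₀ j else 0)
        = (s - lam i₀) ^ m * ∑ j ∈ Finset.Icc 1 (r i₀), ((s - lam i₀) ^ j)⁻¹ * c i₀ j := by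
      rw [Finset.mul_sum]
      apply Finset.sum_congr rfl
      intro j hj
      split_ifs with hjm
      · rw [pow_sub₀ _ hne hjm, mul_assoc]
      · rw [hz j (by omega) (Finset.mem_Icc.1 hj).2]; simp
    simp only [G]
    rw [e2, ← mul_add, e, mul_zero]
  have hlim : G (lam i₀) = 0 := by
    have t1 := hcont.tendsto.mono_left (nhdsWithin_le_nhds (s := {lam i₀}ᶜ))
    have t2 : Filter.Tendsto G (nhdsWithin (lam i₀) {lam i₀}ᶜ) (nhds 0) :=
      tendsto_const_nhds.congr' (hev.mono fun s hs => hs.symm)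
    exact tendsto_nhds_unique t1 t2
  have hval : G (lam i₀) = c i₀ m := by
    simp only [G, sub_self]
    rw [zero_pow (by omega), zero_mul, zero_add,
      Finset.sum_eq_single_of_mem m (Finset.mem_Icc.2 ⟨h1, hm⟩)]
    · simp
    · intro j _ hjm
      split_ifs with hle
      · rw [zero_pow (by omega), zero_mul]
      · rfl
  rw [← hval, hlim]

theorem pf_unique_all {k : ℕ} (lam : Fin k → ℂ) (hlam : Function.Injective lam)
    (r : Fin k → ℕ) (c : Fin k → ℕ → ℂ)
    (h : ∀ s : ℂ, (∀ i, s ≠ lam i) →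
      ∑ i, ∑ j ∈ Finset.Icc 1 (r i), ((s - lam i) ^ j)⁻¹ * c i j = 0)
    (i₀ : Fin k) (d : ℕ) : ∀ m, 1 ≤ m → m ≤ r i₀ → r i₀ - m = d → c i₀ m = 0 := by
  induction d using Nat.strong_induction_on with
  | _ d ih =>
    intro m h1 hm hd
    exact pf_unique lam hlam r c h i₀ m h1 hm fun j hj hjr =>
      ih (r i₀ - j) (by omega) j (by omega) hjr rfl

/-- `B i 1` commutes with `A`. -/
theorem leading_projector_commutes
    (n k : ℕ) (hn : 1 ≤ n)
    (A : Matrix (Fin n) (Fin n) ℂ)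
    (lam : Fin k → ℂ) (hlam : Function.Injective lam)
    (r : Fin k → ℕ) (hr : ∀ i, 1 ≤ r i)
    (hsum : ∑ i, r i = n)
    (hchar : A.charpoly = ∏ i, (X - C (lam i)) ^ r i)
    (B : Fin k → ℕ → Matrix (Fin n) (Fin n) ℂ)
    (hB : ∀ s : ℂ, (∀ i, s ≠ lam i) →
      (s • (1 : Matrix (Fin n) (Fin n) ℂ) - A)⁻¹
        = ∑ i, ∑ j ∈ Finset.Icc 1 (r i), ((s - lam i) ^ j)⁻¹ • B i j)
    :
    ∀ i : Fin k, A * B i 1 = B i 1 * A := by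
  intro i
  have key : ∀ s : ℂ, (∀ i, s ≠ lam i) →
      ∑ i, ∑ j ∈ Finset.Icc 1 (r i), ((s - lam i) ^ j)⁻¹ • (A * B i j - B i j * A) = 0 := by
    intro s hs
    have hc : A * (s • (1 : Matrix (Fin n) (Fin n) ℂ) - A)⁻¹
        = (s • (1 : Matrix (Fin n) (Fin n) ℂ) - A)⁻¹ * A := by
      set M := s • (1 : Matrix (Fin n) (Fin n) ℂ) - A with hM
      have hcm : A * M = M * A := by
        simp [hM, mul_sub, sub_mul]
      by_cases hu : IsUnit M.det
      · calc A * M⁻¹ = M⁻¹ * M * (A * M⁻¹) := by rw [nonsing_inv_mul _ hu, one_mul]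
          _ = M⁻¹ * (M * A) * M⁻¹ := by simp only [mul_assoc]
          _ = M⁻¹ * A * (M * M⁻¹) := by rw [← hcm]; simp only [mul_assoc]
          _ = M⁻¹ * A := by rw [mul_nonsing_inv _ hu, mul_one]
      · rw [nonsing_inv_apply_not_isUnit _ hu]; simp
    rw [hB s hs] at hc
    have := sub_eq_zero.2 hc
    simpa [Finset.mul_sum, Finset.sum_mul, smul_sub, Finset.sum_sub_distrib] using this
  rw [← sub_eq_zero]
  ext a b
  refine pf_unique_all lam hlam r (fun i j => (A * B i j - B i j * A) a b) ?_ i _ 1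
    le_rfl (hr i) rfl
  intro s hs
  have := congrFun (congrFun (key s hs) a) b
  simpa only [Matrix.sum_apply, Matrix.smul_apply, smul_eq_mul, Matrix.zero_apply] using this
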